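/- arXiv:2105.09801 — 3 statements merged into one kernel-verified Lean document; each statement's English description precedes it below -/
import Mathlib

section
/- Let 1 ≤ l ≤ k be integers and let w_1, …, w_k be exchangeable, almost surely strictly positive, integrable real random variables such that log((1/m) Σ_{i=1}^m w_i) is integrable for m = l and m = k. Then E[log((1/k) Σ_{i=1}^k w_i)] ≥ E[log((1/l) Σ_{i=1}^l w_i)]. -/
open MeasureTheory

/-- Jensen's inequality for the logarithm over the cyclic windows of length `l`. -/
theorem average_log_cyclic_windows_le {k l : ℕ} [NeZero k] (hl : 1 ≤ l) (hlk : l ≤ k)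
    (x : Fin k → ℝ) (hx : ∀ i, 0 < x i) :
    ∑ j : Fin k, (k : ℝ)⁻¹ * Real.log ((∑ i : Fin l, x (Fin.castLE hlk i + j)) / l) ≤
      Real.log ((∑ i, x i) / k) := by
  have hk0 : (k : ℝ) ≠ 0 := Nat.cast_ne_zero.2 (NeZero.ne k)
  have hl0 : (0 : ℝ) < l := by exact_mod_cast hl
  have : Nonempty (Fin l) := ⟨⟨0, hl⟩⟩
  have hJensen := strictConcaveOn_log_Ioi.concaveOn.le_map_sum (t := Finset.univ)
    (w := fun _ : Fin k => (k : ℝ)⁻¹)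
    (p := fun j => (∑ i : Fin l, x (Fin.castLE hlk i + j)) / l)
    (fun _ _ => by positivity) (by simp [hk0])
    (fun j _ => Set.mem_Ioi.2
      (div_pos (Finset.sum_pos (fun i _ => hx _) Finset.univ_nonempty) hl0))
  have hmean : ∑ j : Fin k, (k : ℝ)⁻¹ * ((∑ i : Fin l, x (Fin.castLE hlk i + j)) / l) =
      (∑ i, x i) / k := by
    rw [← Finset.mul_sum, ← Finset.sum_div, Finset.sum_comm]
    have hshift (i : Fin l) : ∑ j, x (Fin.castLE hlk i + j) = ∑ j, x j :=
      Equiv.sum_comp (Equiv.addLeft (Fin.castLE hlk i)) x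
    simp only [hshift, Finset.sum_const, Finset.card_univ, Fintype.card_fin, nsmul_eq_mul]
    field_simp
  simp only [smul_eq_mul] at hJensen
  rwa [hmean] at hJensen

/-- monotonicity of the importance-weighted log-average for exchangeable
weights: if `W = (w_1, …, w_k)` is exchangeable (its law is invariant under every permutation
of the indices), almost surely strictly positive, each coordinate is integrable, and the
log-averages over the first `l` and over all `k` coordinates are integrable (`1 ≤ l ≤ k`),
then `E[log((1/l) ∑_{i=1}^l w_i)] ≤ E[log((1/k) ∑_{i=1}^k w_i)]`. -/
theorem log_average_monotone_of_exchangeable {Ω : Type*} [MeasurableSpace Ω]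
    (μ : Measure Ω) [IsProbabilityMeasure μ]
    (k l : ℕ) (hl : 1 ≤ l) (hlk : l ≤ k)
    (W : Ω → Fin k → ℝ) (hWmeas : Measurable W)
    (hexch : ∀ σ : Equiv.Perm (Fin k),
      Measure.map (fun ω => W ω ∘ σ) μ = Measure.map W μ)
    (hpos : ∀ᵐ ω ∂μ, ∀ i, 0 < W ω i)
    (hint : ∀ i, Integrable (fun ω => W ω i) μ)
    (hlogl : Integrable (fun ω => Real.log ((∑ i : Fin l, W ω (Fin.castLE hlk i)) / l)) μ)
    (hlogk : Integrable (fun ω => Real.log ((∑ i, W ω i) / k)) μ) :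
    ∫ ω, Real.log ((∑ i : Fin l, W ω (Fin.castLE hlk i)) / l) ∂μ ≤
      ∫ ω, Real.log ((∑ i, W ω i) / k) ∂μ := by
  have : NeZero k := ⟨by omega⟩
  let f : (Fin k → ℝ) → ℝ := fun x => Real.log ((∑ i : Fin l, x (Fin.castLE hlk i)) / l)
  have hf : Measurable f := by fun_prop
  have hident (j : Fin k) : ProbabilityTheory.IdentDistrib
      (fun ω => f (W ω ∘ Equiv.addRight j)) (fun ω => f (W ω)) μ μ :=
    ProbabilityTheory.IdentDistrib.comp
      ⟨by fun_prop, hWmeas.aemeasurable, hexch (Equiv.addRight j)⟩ hf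
  have hintegrable (j : Fin k) : Integrable (fun ω => f (W ω ∘ Equiv.addRight j)) μ :=
    (hident j).integrable_iff.2 hlogl
  calc ∫ ω, f (W ω) ∂μ
      = ∑ j : Fin k, (k : ℝ)⁻¹ * ∫ ω, f (W ω ∘ Equiv.addRight j) ∂μ := by
        simp only [(hident _).integral_eq]
        simp [NeZero.ne k]
    _ = ∫ ω, ∑ j : Fin k, (k : ℝ)⁻¹ * f (W ω ∘ Equiv.addRight j) ∂μ := by
        rw [integral_finsetSum _ fun j _ => (hintegrable j).const_mul _]
        simp only [integral_const_mul]
    _ ≤ ∫ ω, Real.log ((∑ i, W ω i) / k) ∂μ := by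
        refine integral_mono_ae
          (integrable_finsetSum _ fun j _ => (hintegrable j).const_mul _) hlogk ?_
        filter_upwards [hpos] with ω hω
        exact average_log_cyclic_windows_le hl hlk (W ω) hω
end

section
/- (Proposition 1(c), Consistency.) Suppose that for every 1 ≤ t ≤ T there is a constant M_t such that w_t ≤ M_t almost surely under Q_t^1 and log w_t is Q_t^1-integrable (i.e., the ratios p(z_1, x_1)/q(z_1|x_1) and p(z_{1:t}, x_{1:t})/(p(z_{1:t-1}, x_{1:t-1}) q(z_t|z_{1:t-1}, x_{1:t})) are bounded). Then lim_{K→∞} L_MCFO^K = log p(x_{1:T}). -/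
open MeasureTheory Filter

namespace MCFO

/-- The latent space at a single time step: `ℝ^dz`. -/
abbrev Zsp (dz : ℕ) : Type := Fin dz → ℝ

/-- Latent trajectories `z_{1:t+1}` (time is indexed from `0`, so index `t` corresponds to
the paper's time `t+1`). -/
abbrev Traj (dz t : ℕ) : Type := Fin (t + 1) → Zsp dz

/-- Importance weights `w_t`.  Here `pz t z` denotes the joint density `p(z_{1:t+1}, x_{1:t+1})`
(with the observations fixed) and `q t h ζ` the proposal density `q(z_{t+1} | z_{1:t}, x_{1:t+1})`.
Division by zero in `ℝ` yields `0`, so the weight is `0` wherever the denominator vanishes. -/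
noncomputable def w {dz : ℕ} (pz : (t : ℕ) → Traj dz t → ℝ)
    (q : (t : ℕ) → (Fin t → Zsp dz) → Zsp dz → ℝ) : (t : ℕ) → Traj dz t → ℝ
  | 0, z => pz 0 z / q 0 Fin.elim0 (z 0)
  | t + 1, z =>
      pz (t + 1) z / (pz t (Fin.init z) * q (t + 1) (Fin.init z) (z (Fin.last (t + 1))))

/-- Density of the single-trajectory sampling law `Q_t^1`:
`p(z_{1:t-1} | x_{1:t-1}) · q(z_t | z_{1:t-1}, x_{1:t})` (in the paper's indexing). -/
noncomputable def Qdens {dz : ℕ} (pz : (t : ℕ) → Traj dz t → ℝ) (pX : ℕ → ℝ)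
    (q : (t : ℕ) → (Fin t → Zsp dz) → Zsp dz → ℝ) : (t : ℕ) → Traj dz t → ℝ
  | 0, z => q 0 Fin.elim0 (z 0)
  | t + 1, z => pz t (Fin.init z) / pX t * q (t + 1) (Fin.init z) (z (Fin.last (t + 1)))

/-- The law `Q_t^1` of a single sampled trajectory. -/
noncomputable def Q1 {dz : ℕ} (pz : (t : ℕ) → Traj dz t → ℝ) (pX : ℕ → ℝ)
    (q : (t : ℕ) → (Fin t → Zsp dz) → Zsp dz → ℝ) (t : ℕ) : Measure (Traj dz t) :=
  volume.withDensity fun z => ENNReal.ofReal (Qdens pz pX q t z)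

/-- The law `Q_t^K` of `K` i.i.d. sampled trajectories. -/
noncomputable def QK {dz : ℕ} (pz : (t : ℕ) → Traj dz t → ℝ) (pX : ℕ → ℝ)
    (q : (t : ℕ) → (Fin t → Zsp dz) → Zsp dz → ℝ) (t K : ℕ) :
    Measure (Fin K → Traj dz t) :=
  Measure.pi fun _ => Q1 pz pX q t

/-- The estimator `R_t^K = (1/K) ∑_i w_t(z_{1:t}^i)`. -/
noncomputable def R {dz : ℕ} (pz : (t : ℕ) → Traj dz t → ℝ)
    (q : (t : ℕ) → (Fin t → Zsp dz) → Zsp dz → ℝ) (t K : ℕ)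
    (zs : Fin K → Traj dz t) : ℝ :=
  (∑ i, w pz q t (zs i)) / K

/-- The Monte Carlo objective `L_t^K = E_{Q_t^K}[log R_t^K]`. -/
noncomputable def L {dz : ℕ} (pz : (t : ℕ) → Traj dz t → ℝ) (pX : ℕ → ℝ)
    (q : (t : ℕ) → (Fin t → Zsp dz) → Zsp dz → ℝ) (t K : ℕ) : ℝ :=
  ∫ zs, Real.log (R pz q t K zs) ∂(QK pz pX q t K)

/-- The Monte Carlo filtering objective `L_MCFO^K = ∑_{t=1}^T L_t^K`. -/
noncomputable def LMCFO {dz : ℕ} (pz : (t : ℕ) → Traj dz t → ℝ) (pX : ℕ → ℝ)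
    (q : (t : ℕ) → (Fin t → Zsp dz) → Zsp dz → ℝ) (T K : ℕ) : ℝ :=
  ∑ t ∈ Finset.range T, L pz pX q t K

/-- The conditional marginal likelihood `p(x_t | x_{1:t-1})` (with `p(x_1 | x_{1:0}) = p(x_1)`). -/
noncomputable def pcond (pX : ℕ → ℝ) : ℕ → ℝ
  | 0 => pX 0
  | t + 1 => pX (t + 1) / pX t

/-! ### Consistency of the logarithm of an empirical mean -/

lemma abs_log_sub_log_le {x y δ : ℝ} (hδ : 0 < δ) (hx : δ ≤ x) (hy : δ ≤ y) :
    |Real.log x - Real.log y| ≤ δ⁻¹ * |x - y| := by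
  wlog h : y ≤ x generalizing x y
  · rw [abs_sub_comm, abs_sub_comm x y]
    exact this hy hx (le_of_not_ge h)
  have hy0 : 0 < y := hδ.trans_le hy
  have hx0 : 0 < x := hδ.trans_le hx
  rw [abs_of_nonneg (sub_nonneg.2 (Real.log_le_log hy0 h)), abs_of_nonneg (sub_nonneg.2 h),
    ← Real.log_div hx0.ne' hy0.ne']
  calc Real.log (x / y) ≤ x / y - 1 := Real.log_le_sub_one_of_pos (by positivity)
    _ = y⁻¹ * (x - y) := by field_simp
    _ ≤ δ⁻¹ * (x - y) := by
      gcongr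

lemma abs_le_add_sq_div {c : ℝ} (hc : 0 < c) (x : ℝ) : |x| ≤ c + x ^ 2 / c := by
  rw [← sq_abs, ← sub_nonneg]
  have : c + |x| ^ 2 / c - |x| = ((|x| - c) ^ 2 + c * |x|) / c := by field_simp; ring
  rw [this]
  positivity

/-- `leaveOneOut i j x` is the `j`-th factor of a product in which the `i`-th coordinate
contributes `|log x|` and every other coordinate contributes `exp (-x)`. -/
noncomputable def leaveOneOut {n : ℕ} (i j : Fin n) (x : ℝ) : ℝ :=
  if j = i then |Real.log x| else Real.exp (-x)

lemma leaveOneOut_nonneg {n : ℕ} (i j : Fin n) (x : ℝ) : 0 ≤ leaveOneOut i j x := by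
  unfold leaveOneOut
  split_ifs <;> positivity

lemma prod_leaveOneOut {n : ℕ} (i : Fin n) (a : Fin n → ℝ) :
    ∏ j, leaveOneOut i j (a j) =
      |Real.log (a i)| * Real.exp (-∑ j ∈ Finset.univ.erase i, a j) := by
  rw [← Finset.mul_prod_erase _ _ (Finset.mem_univ i), ← Finset.sum_neg_distrib, Real.exp_sum]
  congr 1
  · simp [leaveOneOut]
  · refine Finset.prod_congr rfl fun j hj => ?_
    simp [leaveOneOut, (Finset.mem_erase.1 hj).1]

lemma abs_log_average_le {n : ℕ} {a : Fin (n + 1) → ℝ} (ha : ∀ i, 0 ≤ a i) {s : ℝ}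
    (hs : s = ∑ i, a i) (hs1 : s / ((n + 1 : ℕ) : ℝ) ≤ 1) :
    |Real.log (s / ((n + 1 : ℕ) : ℝ))| ≤
      ∑ i, |Real.log (a i)| + Real.log ((n + 1 : ℕ) : ℝ) := by
  have hlogK : 0 ≤ Real.log ((n + 1 : ℕ) : ℝ) := Real.log_natCast_nonneg _
  have hsum : 0 ≤ ∑ i, |Real.log (a i)| := Finset.sum_nonneg fun i _ => abs_nonneg _
  rcases (Finset.sum_nonneg fun i (_ : i ∈ Finset.univ) => ha i).eq_or_lt' with h0 | h0
  · rw [hs, h0]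
    simpa using add_nonneg hsum hlogK
  obtain ⟨i, -, hi⟩ : ∃ i ∈ Finset.univ, 0 < a i := by
    by_contra! h
    exact absurd (Finset.sum_nonpos h) (not_le.2 h0)
  rw [← hs] at h0
  have hK : (0 : ℝ) < ((n + 1 : ℕ) : ℝ) := by positivity
  rw [abs_of_nonpos (Real.log_nonpos (by positivity) hs1), Real.log_div h0.ne' hK.ne']
  have h1 : Real.log (a i) ≤ Real.log s := by
    apply Real.log_le_log hi
    rw [hs]
    exact Finset.single_le_sum (fun j _ => ha j) (Finset.mem_univ i)
  have h2 : |Real.log (a i)| ≤ ∑ i, |Real.log (a i)| :=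
    Finset.single_le_sum (f := fun i => |Real.log (a i)|) (fun j _ => abs_nonneg _)
      (Finset.mem_univ i)
  linarith [neg_abs_le (Real.log (a i))]

lemma abs_log_average_sub_log_le {n : ℕ} {a : Fin (n + 1) → ℝ} (ha : ∀ i, 0 ≤ a i)
    {m δ c : ℝ} (hδ : 0 < δ) (hδ1 : δ ≤ 1) (hδm : δ ≤ m) (hc : 0 < c) :
    |Real.log ((∑ i, a i) / ((n + 1 : ℕ) : ℝ)) - Real.log m| ≤
      δ⁻¹ * (c + ((∑ i, a i) / ((n + 1 : ℕ) : ℝ) - m) ^ 2 / c) +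
      Real.exp δ ^ (n + 1) * (∑ i, ∏ j, leaveOneOut i j (a j) +
        (Real.log ((n + 1 : ℕ) : ℝ) + |Real.log m|) * ∏ j, Real.exp (-a j)) := by
  have hK : (0 : ℝ) < ((n + 1 : ℕ) : ℝ) := by positivity
  have hlogK : 0 ≤ Real.log ((n + 1 : ℕ) : ℝ) := Real.log_natCast_nonneg _
  have hprod : 0 ≤ ∑ i, ∏ j, leaveOneOut i j (a j) :=
    Finset.sum_nonneg fun i _ => Finset.prod_nonneg fun j _ => leaveOneOut_nonneg i j _
  rcases le_or_gt δ ((∑ i, a i) / ((n + 1 : ℕ) : ℝ)) with h | h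
  · refine ((abs_log_sub_log_le hδ h hδm).trans ?_).trans
      (le_add_of_nonneg_right (by positivity))
    gcongr
    exact abs_le_add_sq_div hc _
  · refine le_trans ?_ (le_add_of_nonneg_left (by positivity))
    have hexp : Real.exp δ ^ (n + 1) = Real.exp (((n + 1 : ℕ) : ℝ) * δ) := by
      rw [← Real.exp_nat_mul]
    have hs : ∑ i, a i ≤ ((n + 1 : ℕ) : ℝ) * δ := by
      rw [div_lt_iff₀ hK] at h
      linarith
    calc |Real.log ((∑ i, a i) / ((n + 1 : ℕ) : ℝ)) - Real.log m|
        ≤ |Real.log ((∑ i, a i) / ((n + 1 : ℕ) : ℝ))| + |Real.log m| := abs_sub _ _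
      _ ≤ (∑ i, |Real.log (a i)| + Real.log ((n + 1 : ℕ) : ℝ)) + |Real.log m| := by
        gcongr
        exact abs_log_average_le ha rfl (h.le.trans hδ1)
      _ = ∑ i, |Real.log (a i)| + (Real.log ((n + 1 : ℕ) : ℝ) + |Real.log m|) := by ring
      _ ≤ _ := by
        rw [hexp, mul_add, Finset.mul_sum]
        gcongr with i
        · rw [prod_leaveOneOut, mul_left_comm, ← Real.exp_add]
          refine le_mul_of_one_le_right (abs_nonneg _) (Real.one_le_exp ?_)
          have := Finset.sum_le_sum_of_subset_of_nonneg (Finset.erase_subset i Finset.univ)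
            (fun j _ _ => ha j)
          linarith
        · rw [mul_left_comm, ← Real.exp_sum, ← Real.exp_add, Finset.sum_neg_distrib]
          refine le_mul_of_one_le_right (by positivity) (Real.one_le_exp ?_)
          linarith

lemma integrable_leaveOneOut {X : Type*} [MeasurableSpace X] {μ : Measure X} {f : X → ℝ}
    (hexp : Integrable (fun x => Real.exp (-f x)) μ)
    (hlog : Integrable (fun x => Real.log (f x)) μ) {n : ℕ} (i j : Fin n) :
    Integrable (fun x => leaveOneOut i j (f x)) μ := by
  unfold leaveOneOut
  split_ifs
  exacts [hlog.abs, hexp]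

section EmpiricalMean

variable {X : Type*} [MeasurableSpace X] {μ : Measure X} [IsProbabilityMeasure μ] {f : X → ℝ}

lemma integral_sq_average_sub (hf : MemLp f 2 μ) (n : ℕ) :
    ∫ x : Fin (n + 1) → X, ((∑ i, f (x i)) / ((n + 1 : ℕ) : ℝ) - ∫ y, f y ∂μ) ^ 2
      ∂(Measure.pi fun _ => μ) =
      ProbabilityTheory.variance f μ / ((n + 1 : ℕ) : ℝ) := by
  have hK : ((n + 1 : ℕ) : ℝ) ≠ 0 := by positivity
  have hi : Integrable f μ := hf.integrable (by norm_num)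
  have hmean : ∫ x : Fin (n + 1) → X, (∑ i, f (x i)) ∂(Measure.pi fun _ => μ) =
      ((n + 1 : ℕ) : ℝ) * ∫ y, f y ∂μ := by
    rw [integral_finsetSum _ fun i _ => integrable_comp_eval (μ := fun _ => μ) (i := i) hi]
    simp_rw [integral_comp_eval (μ := fun _ : Fin (n + 1) => μ) hi.aestronglyMeasurable]
    simp
  have hvar := ProbabilityTheory.variance_sum_pi (ι := Fin (n + 1)) (μ := fun _ => μ)
    (X := fun _ => f) (fun _ => hf)
  have hmeas : AEMeasurable (∑ i : Fin (n + 1), fun x : Fin (n + 1) → X => f (x i))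
      (Measure.pi fun _ => μ) :=
    (integrable_finsetSum' _ fun i _ =>
      integrable_comp_eval (μ := fun _ => μ) (i := i) hi).aemeasurable
  rw [ProbabilityTheory.variance_eq_integral hmeas] at hvar
  simp only [Finset.sum_apply, hmean, Finset.sum_const, Finset.card_univ, Fintype.card_fin,
    nsmul_eq_mul] at hvar
  calc _ = ∫ x : Fin (n + 1) → X, (((n + 1 : ℕ) : ℝ) ^ 2)⁻¹ *
        ((∑ i, f (x i)) - ((n + 1 : ℕ) : ℝ) * ∫ y, f y ∂μ) ^ 2 ∂(Measure.pi fun _ => μ) := by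
        congr with x
        field_simp
    _ = _ := by
        rw [integral_const_mul, hvar]
        field_simp

lemma integrable_sq_average_sub (hf : MemLp f 2 μ) (n : ℕ) (m : ℝ) :
    Integrable (fun x : Fin (n + 1) → X => ((∑ i, f (x i)) / ((n + 1 : ℕ) : ℝ) - m) ^ 2)
      (Measure.pi fun _ => μ) := by
  have h : MemLp (fun x : Fin (n + 1) → X => (∑ i, f (x i)) / ((n + 1 : ℕ) : ℝ) - m) 2
      (Measure.pi fun _ => μ) := by
    refine MemLp.sub ?_ (memLp_const m)
    have hi (i : Fin (n + 1)) :
        MemLp (fun x : Fin (n + 1) → X => f (x i)) 2 (Measure.pi fun _ => μ) :=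
      hf.comp_measurePreserving (measurePreserving_eval (fun _ : Fin (n + 1) => μ) i)
    have hsum := (memLp_finsetSum Finset.univ fun i _ => hi i).const_mul (((n + 1 : ℕ) : ℝ)⁻¹)
    simpa only [div_eq_inv_mul] using hsum
  exact h.integrable_sq

lemma integral_prod_leaveOneOut {n : ℕ} (i : Fin (n + 1)) :
    ∫ x : Fin (n + 1) → X, ∏ j, leaveOneOut i j (f (x j)) ∂(Measure.pi fun _ => μ) =
      (∫ x, |Real.log (f x)| ∂μ) * (∫ x, Real.exp (-f x) ∂μ) ^ n := by
  rw [integral_fintype_prod_eq_prod (fun j x => leaveOneOut i j (f x)),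
    ← Finset.mul_prod_erase _ _ (Finset.mem_univ i)]
  congr 1
  · simp [leaveOneOut]
  · rw [Finset.prod_congr rfl (g := fun _ => ∫ x, Real.exp (-f x) ∂μ)]
    · simp
    · intro j hj
      simp [leaveOneOut, (Finset.mem_erase.1 hj).1]

lemma integral_exp_neg_lt_one (hf0 : ∀ x, 0 ≤ f x) (hf : Integrable f μ)
    (hm : 0 < ∫ x, f x ∂μ) (hexp : Integrable (fun x => Real.exp (-f x)) μ) :
    ∫ x, Real.exp (-f x) ∂μ < 1 := by
  have hle : ∀ x, 0 ≤ 1 - Real.exp (-f x) := fun x => by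
    simpa using hf0 x
  have hint : Integrable (fun x => 1 - Real.exp (-f x)) μ := (integrable_const 1).sub hexp
  have h : 0 < ∫ x, (1 - Real.exp (-f x)) ∂μ := by
    rw [integral_pos_iff_support_of_nonneg hle hint]
    rw [integral_pos_iff_support_of_nonneg hf0 hf] at hm
    convert hm using 2
    ext x
    simp [sub_eq_zero, eq_comm (a := (1 : ℝ))]
  rw [integral_sub (integrable_const 1) hexp] at h
  simpa using h

theorem tendsto_integral_log_average (hf0 : ∀ x, 0 ≤ f x) (hf : MemLp f 2 μ)
    (hm : 0 < ∫ x, f x ∂μ) (hlog : Integrable (fun x => Real.log (f x)) μ)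
    (hint : ∀ K : ℕ, Integrable (fun x : Fin K → X => Real.log ((∑ i, f (x i)) / K))
      (Measure.pi fun _ => μ)) :
    Tendsto (fun K : ℕ => ∫ x : Fin K → X, Real.log ((∑ i, f (x i)) / K)
      ∂(Measure.pi fun _ => μ)) atTop (nhds (Real.log (∫ x, f x ∂μ))) := by
  set m := ∫ x, f x ∂μ with hm_def
  have hi : Integrable f μ := hf.integrable (by norm_num)
  have hexp : Integrable (fun x => Real.exp (-f x)) μ := by
    refine Integrable.of_bound (C := 1)
      (Real.continuous_exp.comp_aestronglyMeasurable hi.aestronglyMeasurable.neg) ?_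
    filter_upwards with x
    simpa using hf0 x
  set ρ := ∫ x, Real.exp (-f x) ∂μ with hρ_def
  have hρ0 : 0 < ρ := integral_exp_pos hexp
  have hρ1 : ρ < 1 := integral_exp_neg_lt_one hf0 hi hm hexp
  set G := ∫ x, |Real.log (f x)| ∂μ with hG
  set V := ProbabilityTheory.variance f μ with hV
  obtain ⟨δ, hδ, hδ1, hδm, hδρ⟩ :
      ∃ δ : ℝ, 0 < δ ∧ δ ≤ 1 ∧ δ ≤ m ∧ Real.exp δ * ρ < 1 := by
    have hlogρ : 0 < -Real.log ρ := neg_pos.2 (Real.log_neg hρ0 hρ1)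
    refine ⟨min (min 1 m) (-Real.log ρ / 2), by positivity,
      (min_le_left _ _).trans (min_le_left _ _), (min_le_left _ _).trans (min_le_right _ _), ?_⟩
    nth_rw 2 [← Real.exp_log hρ0]
    rw [← Real.exp_add, Real.exp_lt_one_iff]
    linarith [min_le_right (min 1 m) (-Real.log ρ / 2)]
  set r := Real.exp δ * ρ with hr
  have hr0 : 0 < r := by positivity
  rw [← tendsto_add_atTop_iff_nat 1, tendsto_iff_norm_sub_tendsto_zero]
  have hbound : ∀ n : ℕ,
      ‖(∫ x : Fin (n + 1) → X, Real.log ((∑ i, f (x i)) / ((n + 1 : ℕ) : ℝ))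
        ∂(Measure.pi fun _ => μ)) - Real.log m‖ ≤
      δ⁻¹ * ((1 + V) * (Real.sqrt ((n + 1 : ℕ) : ℝ))⁻¹) +
        (Real.exp δ * G * (((n + 1 : ℕ) : ℝ) * r ^ n) +
          (((n + 1 : ℕ) : ℝ) + |Real.log m|) * r ^ (n + 1)) := by
    intro n
    have hK : (0 : ℝ) < ((n + 1 : ℕ) : ℝ) := by positivity
    set c := (Real.sqrt ((n + 1 : ℕ) : ℝ))⁻¹ with hc_def
    have hc : 0 < c := by positivity
    have hcK : ((n + 1 : ℕ) : ℝ)⁻¹ = c * c := by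
      rw [hc_def, ← mul_inv, Real.mul_self_sqrt hK.le]
    have hsq := integrable_sq_average_sub hf n m
    have hloo (i : Fin (n + 1)) : Integrable
        (fun x : Fin (n + 1) → X => ∏ j, leaveOneOut i j (f (x j))) (Measure.pi fun _ => μ) :=
      Integrable.fintype_prod fun j => integrable_leaveOneOut hexp hlog i j
    have hpe : Integrable (fun x : Fin (n + 1) → X => ∏ j, Real.exp (-f (x j)))
        (Measure.pi fun _ => μ) :=
      Integrable.fintype_prod (f := fun _ x => Real.exp (-f x)) fun _ => hexp
    have hA : Integrable (fun x : Fin (n + 1) → X =>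
        δ⁻¹ * (c + ((∑ i, f (x i)) / ((n + 1 : ℕ) : ℝ) - m) ^ 2 / c))
        (Measure.pi fun _ => μ) :=
      ((integrable_const c).add (hsq.div_const c)).const_mul _
    have hS : Integrable (fun x : Fin (n + 1) → X => ∑ i, ∏ j, leaveOneOut i j (f (x j)))
        (Measure.pi fun _ => μ) := integrable_finsetSum _ fun i _ => hloo i
    have hE := hpe.const_mul (Real.log ((n + 1 : ℕ) : ℝ) + |Real.log m|)
    have hB : Integrable (fun x : Fin (n + 1) → X => Real.exp δ ^ (n + 1) *
        (∑ i, ∏ j, leaveOneOut i j (f (x j)) +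
          (Real.log ((n + 1 : ℕ) : ℝ) + |Real.log m|) * ∏ j, Real.exp (-f (x j))))
        (Measure.pi fun _ => μ) := (hS.add hE).const_mul _
    calc _ = ‖∫ x : Fin (n + 1) → X, (Real.log ((∑ i, f (x i)) / ((n + 1 : ℕ) : ℝ)) -
            Real.log m) ∂(Measure.pi fun _ => μ)‖ := by
          rw [integral_sub (hint (n + 1)) (integrable_const _)]
          simp
      _ ≤ ∫ x : Fin (n + 1) → X,
          (δ⁻¹ * (c + ((∑ i, f (x i)) / ((n + 1 : ℕ) : ℝ) - m) ^ 2 / c) +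
          Real.exp δ ^ (n + 1) * (∑ i, ∏ j, leaveOneOut i j (f (x j)) +
            (Real.log ((n + 1 : ℕ) : ℝ) + |Real.log m|) * ∏ j, Real.exp (-f (x j))))
          ∂(Measure.pi fun _ => μ) := by
          refine norm_integral_le_of_norm_le (hA.add hB) ?_
          filter_upwards with x
          exact abs_log_average_sub_log_le (fun i => hf0 (x i)) hδ hδ1 hδm hc
      _ = δ⁻¹ * (c + V / ((n + 1 : ℕ) : ℝ) / c) +
          Real.exp δ ^ (n + 1) * (((n + 1 : ℕ) : ℝ) * (G * ρ ^ n) +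
            (Real.log ((n + 1 : ℕ) : ℝ) + |Real.log m|) * ρ ^ (n + 1)) := by
          rw [integral_add hA hB, integral_const_mul, integral_const_mul,
            integral_add (integrable_const c) (hsq.div_const c), integral_add hS hE,
            integral_div, integral_sq_average_sub hf n, integral_const_mul,
            integral_finsetSum _ fun i _ => hloo i]
          simp_rw [integral_prod_leaveOneOut]
          rw [integral_fintype_prod_eq_pow (fun x => Real.exp (-f x))]
          simp [G, ρ, V]
      _ ≤ δ⁻¹ * (c + V / ((n + 1 : ℕ) : ℝ) / c) +
          Real.exp δ ^ (n + 1) * (((n + 1 : ℕ) : ℝ) * (G * ρ ^ n) +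
            (((n + 1 : ℕ) : ℝ) + |Real.log m|) * ρ ^ (n + 1)) := by
          gcongr
          exact Real.log_le_self hK.le
      _ = _ := by
          rw [div_eq_mul_inv V, hcK, hr, mul_pow, mul_pow]
          field_simp
          ring
  refine squeeze_zero (fun _ => norm_nonneg _) hbound ?_
  have h1 : Tendsto (fun n : ℕ => (Real.sqrt ((n + 1 : ℕ) : ℝ))⁻¹) atTop (nhds 0) :=
    tendsto_inv_atTop_zero.comp <| Real.tendsto_sqrt_atTop.comp <|
      tendsto_natCast_atTop_atTop.comp (tendsto_add_atTop_nat 1)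
  have h2 : Tendsto (fun n : ℕ => r ^ n) atTop (nhds 0) :=
    tendsto_pow_atTop_nhds_zero_of_lt_one hr0.le hδρ
  have h3 : Tendsto (fun n : ℕ => (n : ℝ) * r ^ n) atTop (nhds 0) :=
    tendsto_self_mul_const_pow_of_lt_one hr0.le hδρ
  have h4 : Tendsto (fun n : ℕ => ((n + 1 : ℕ) : ℝ) * r ^ n) atTop (nhds 0) := by
    simpa [add_mul] using h3.add h2
  have h5 : Tendsto (fun n : ℕ => (((n + 1 : ℕ) : ℝ) + |Real.log m|) * r ^ (n + 1)) atTop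
      (nhds 0) := by
    have := (h4.add (h2.const_mul |Real.log m|)).mul_const r
    simp only [mul_zero, add_zero, zero_mul] at this
    refine this.congr fun n => ?_
    ring
  simpa using ((h1.const_mul (1 + V)).const_mul δ⁻¹).add
    ((h4.const_mul (Real.exp δ * G)).add h5)

end EmpiricalMean

/-! ### The sampling laws and the importance weights -/

lemma lintegral_init_last {E : Type*} [MeasureSpace E] [SigmaFinite (volume : Measure E)]
    {n : ℕ} {F : (Fin n → E) → E → ENNReal} (hF : Measurable (Function.uncurry F)) :
    ∫⁻ z : Fin (n + 1) → E, F (Fin.init z) (z (Fin.last n)) = ∫⁻ h, ∫⁻ ζ, F h ζ := by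
  have he := volume_preserving_piFinSuccAbove (fun _ : Fin (n + 1) => E) (Fin.last n)
  have hG : Measurable fun p : E × (Fin n → E) => F p.2 p.1 := hF.comp measurable_swap
  rw [← lintegral_prod_symm' _ hG, ← Measure.volume_eq_prod, ← he.lintegral_comp hG]
  simp [MeasurableEquiv.piFinSuccAbove]

lemma measurable_init {E : Type*} [MeasurableSpace E] {n : ℕ} :
    Measurable fun z : Fin (n + 1) → E => (Fin.init z : Fin n → E) :=
  measurable_pi_iff.2 fun i => measurable_pi_apply i.castSucc

section Weights

variable {dz : ℕ} {pz : (t : ℕ) → Traj dz t → ℝ} {pX : ℕ → ℝ}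
  {q : (t : ℕ) → (Fin t → Zsp dz) → Zsp dz → ℝ}

lemma measurable_proposal (hq_meas : ∀ t, Measurable (Function.uncurry (q t))) (t : ℕ) :
    Measurable fun z : Traj dz t => q t (Fin.init z) (z (Fin.last t)) :=
  (hq_meas t).comp (measurable_init.prodMk (measurable_pi_apply _))

lemma elim0_eq_init (z : Traj dz 0) : q 0 Fin.elim0 (z 0) = q 0 (Fin.init z) (z (Fin.last 0)) := by
  rw [Subsingleton.elim (Fin.init z) Fin.elim0]
  rfl

lemma measurable_Qdens (hpz_meas : ∀ t, Measurable (pz t))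
    (hq_meas : ∀ t, Measurable (Function.uncurry (q t))) (t : ℕ) :
    Measurable (Qdens pz pX q t) := by
  cases t with
  | zero =>
    exact (funext elim0_eq_init : Qdens pz pX q 0 = _) ▸ measurable_proposal hq_meas 0
  | succ t =>
    exact (((hpz_meas t).comp measurable_init).div_const _).mul (measurable_proposal hq_meas _)

lemma measurable_w (hpz_meas : ∀ t, Measurable (pz t))
    (hq_meas : ∀ t, Measurable (Function.uncurry (q t))) (t : ℕ) :
    Measurable (w pz q t) := by
  cases t with
  | zero =>
    have h : w pz q 0 = fun z => pz 0 z / q 0 (Fin.init z) (z (Fin.last 0)) :=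
      funext fun z => congrArg (pz 0 z / ·) (elim0_eq_init z)
    rw [h]
    exact (hpz_meas 0).div (measurable_proposal hq_meas 0)
  | succ t =>
    exact (hpz_meas _).div
      (((hpz_meas t).comp measurable_init).mul (measurable_proposal hq_meas _))

lemma Qdens_nonneg (hpz_nonneg : ∀ t z, 0 ≤ pz t z) (hq_nonneg : ∀ t h ζ, 0 ≤ q t h ζ)
    (hpX_pos : ∀ t, 0 < pX t) (t : ℕ) (z : Traj dz t) : 0 ≤ Qdens pz pX q t z := by
  cases t with
  | zero => exact hq_nonneg _ _ _
  | succ t => exact mul_nonneg (div_nonneg (hpz_nonneg _ _) (hpX_pos t).le) (hq_nonneg _ _ _)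

lemma w_nonneg (hpz_nonneg : ∀ t z, 0 ≤ pz t z) (hq_nonneg : ∀ t h ζ, 0 ≤ q t h ζ)
    (t : ℕ) (z : Traj dz t) : 0 ≤ w pz q t z := by
  cases t with
  | zero => exact div_nonneg (hpz_nonneg _ _) (hq_nonneg _ _ _)
  | succ t =>
    exact div_nonneg (hpz_nonneg _ _) (mul_nonneg (hpz_nonneg _ _) (hq_nonneg _ _ _))

lemma lintegral_ofReal_eq_one {α : Type*} [MeasurableSpace α] {μ : Measure α} {g : α → ℝ}
    (hg : ∀ x, 0 ≤ g x) (h : ∫ x, g x ∂μ = 1) : ∫⁻ x, ENNReal.ofReal (g x) ∂μ = 1 := by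
  rw [← ofReal_integral_eq_lintegral_ofReal
    (Integrable.of_integral_ne_zero (h ▸ one_ne_zero)) (ae_of_all _ hg), h, ENNReal.ofReal_one]

lemma lintegral_mul_proposal (hq_meas : ∀ t, Measurable (Function.uncurry (q t)))
    (hq_nonneg : ∀ t h ζ, 0 ≤ q t h ζ) (hq_prob : ∀ t h, ∫ ζ, q t h ζ = 1) {t : ℕ}
    {A : (Fin t → Zsp dz) → ℝ} (hA : Measurable A) (hA0 : ∀ h, 0 ≤ A h) :
    ∫⁻ z : Traj dz t, ENNReal.ofReal (A (Fin.init z) * q t (Fin.init z) (z (Fin.last t))) =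
      ∫⁻ h, ENNReal.ofReal (A h) := by
  rw [lintegral_init_last (F := fun h ζ => ENNReal.ofReal (A h * q t h ζ))]
  · refine lintegral_congr fun h => ?_
    simp_rw [ENNReal.ofReal_mul (hA0 h)]
    rw [lintegral_const_mul' _ _ ENNReal.ofReal_ne_top,
      lintegral_ofReal_eq_one (hq_nonneg t h) (hq_prob t h), mul_one]
  · exact ((hA.comp measurable_fst).mul (hq_meas t)).ennreal_ofReal

lemma isProbabilityMeasure_Q1 (hpz_meas : ∀ t, Measurable (pz t))
    (hpz_nonneg : ∀ t z, 0 ≤ pz t z) (hq_meas : ∀ t, Measurable (Function.uncurry (q t)))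
    (hq_nonneg : ∀ t h ζ, 0 ≤ q t h ζ) (hq_prob : ∀ t h, ∫ ζ, q t h ζ = 1)
    (hpX : ∀ t, pX t = ∫ z, pz t z) (hpX_pos : ∀ t, 0 < pX t) (t : ℕ) :
    IsProbabilityMeasure (Q1 pz pX q t) := by
  constructor
  rw [Q1, withDensity_apply _ MeasurableSet.univ, setLIntegral_univ]
  cases t with
  | zero =>
    have h := lintegral_mul_proposal hq_meas hq_nonneg hq_prob (t := 0) (A := fun _ => 1)
      measurable_const fun _ => zero_le_one
    have hvol : (volume : Measure (Fin 0 → Zsp dz)) Set.univ = 1 := by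
      rw [volume_pi, Measure.pi_univ, Finset.univ_eq_empty, Finset.prod_empty]
    rw [ENNReal.ofReal_one, lintegral_const, hvol, one_mul] at h
    simp only [one_mul] at h
    simpa only [Qdens, elim0_eq_init] using h
  | succ t =>
    have h := lintegral_mul_proposal hq_meas hq_nonneg hq_prob (t := t + 1)
      (A := fun h => pz t h / pX t) ((hpz_meas t).div_const _)
      fun h => div_nonneg (hpz_nonneg t h) (hpX_pos t).le
    rw [lintegral_ofReal_eq_one (fun h => div_nonneg (hpz_nonneg t h) (hpX_pos t).le)
      (by rw [integral_div, ← hpX, div_self (hpX_pos t).ne'])] at h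
    exact h

lemma integral_w (hpz_meas : ∀ t, Measurable (pz t)) (hpz_nonneg : ∀ t z, 0 ≤ pz t z)
    (hq_meas : ∀ t, Measurable (Function.uncurry (q t))) (hq_nonneg : ∀ t h ζ, 0 ≤ q t h ζ)
    (hq_pos0 : ∀ z : Traj dz 0, 0 < pz 0 z → 0 < q 0 Fin.elim0 (z 0))
    (hq_pos : ∀ t (z : Traj dz (t + 1)), 0 < pz (t + 1) z →
      0 < q (t + 1) (Fin.init z) (z (Fin.last (t + 1))))
    (hpX : ∀ t, pX t = ∫ z, pz t z) (hpX_pos : ∀ t, 0 < pX t)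
    (hsupp : ∀ t (z : Traj dz (t + 1)), pz t (Fin.init z) = 0 → pz (t + 1) z = 0) (t : ℕ) :
    ∫ z, w pz q t z ∂(Q1 pz pX q t) = pcond pX t := by
  rw [Q1, integral_withDensity_eq_integral_toReal_smul
    (measurable_Qdens hpz_meas hq_meas t).ennreal_ofReal
    (ae_of_all _ fun _ => ENNReal.ofReal_lt_top)]
  simp only [ENNReal.toReal_ofReal (Qdens_nonneg hpz_nonneg hq_nonneg hpX_pos t _), smul_eq_mul]
  cases t with
  | zero =>
    rw [pcond, hpX]
    refine integral_congr_ae (ae_of_all _ fun z => ?_)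
    rcases (hpz_nonneg 0 z).eq_or_lt' with h | h
    · simp [w, h]
    · exact mul_div_cancel₀ _ (hq_pos0 z h).ne'
  | succ t =>
    rw [pcond, hpX (t + 1), ← integral_div]
    refine integral_congr_ae (ae_of_all _ fun z => ?_)
    rcases (hpz_nonneg (t + 1) z).eq_or_lt' with h | h
    · simp [w, h]
    · have h1 := (hq_pos t z h).ne'
      have h2 : pz t (Fin.init z) ≠ 0 := fun h0 => h.ne' (hsupp t z h0)
      have h3 := (hpX_pos t).ne'
      simp only [Qdens, w]
      field_simp

end Weights

lemma pcond_pos {pX : ℕ → ℝ} (hpX_pos : ∀ t, 0 < pX t) (t : ℕ) : 0 < pcond pX t := by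
  cases t with
  | zero => exact hpX_pos 0
  | succ t => exact div_pos (hpX_pos _) (hpX_pos _)

lemma sum_log_pcond {pX : ℕ → ℝ} (hpX_pos : ∀ t, 0 < pX t) (n : ℕ) :
    ∑ t ∈ Finset.range (n + 1), Real.log (pcond pX t) = Real.log (pX n) := by
  induction n with
  | zero => simp [pcond]
  | succ n ih =>
    rw [Finset.sum_range_succ, ih, pcond, Real.log_div (hpX_pos _).ne' (hpX_pos _).ne']
    ring

/-- Proposition 1(c), Consistency: if each importance weight is (essentially)
bounded and has integrable logarithm under `Q_t^1`, then `L_MCFO^K → log p(x_{1:T})` as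
`K → ∞`. -/
theorem LMCFO_consistent {dz T : ℕ} (hdz : 1 ≤ dz) (hT : 1 ≤ T)
    (pz : (t : ℕ) → Traj dz t → ℝ) (pX : ℕ → ℝ)
    (q : (t : ℕ) → (Fin t → Zsp dz) → Zsp dz → ℝ)
    (hpz_meas : ∀ t, Measurable (pz t))
    (hpz_nonneg : ∀ t z, 0 ≤ pz t z)
    (hq_meas : ∀ t, Measurable (Function.uncurry (q t)))
    (hq_nonneg : ∀ t h ζ, 0 ≤ q t h ζ)
    (hq_prob : ∀ t h, ∫ ζ, q t h ζ = 1)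
    (hq_pos0 : ∀ z : Traj dz 0, 0 < pz 0 z → 0 < q 0 Fin.elim0 (z 0))
    (hq_pos : ∀ t (z : Traj dz (t + 1)), 0 < pz (t + 1) z →
      0 < q (t + 1) (Fin.init z) (z (Fin.last (t + 1))))
    (hpX : ∀ t, pX t = ∫ z, pz t z)
    (hpX_pos : ∀ t, 0 < pX t)
    (hsupp : ∀ t (z : Traj dz (t + 1)), pz t (Fin.init z) = 0 → pz (t + 1) z = 0)
    (hint : ∀ t K, Integrable (fun zs => Real.log (R pz q t K zs)) (QK pz pX q t K))
    (hbdd : ∀ t < T, ∃ M : ℝ, ∀ᵐ z ∂(Q1 pz pX q t), w pz q t z ≤ M)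
    (hlogint : ∀ t < T, Integrable (fun z => Real.log (w pz q t z)) (Q1 pz pX q t)) :
    Tendsto (fun K : ℕ => LMCFO pz pX q T K) atTop (nhds (Real.log (pX (T - 1)))) := by
  obtain ⟨n, rfl⟩ : ∃ n, T = n + 1 := ⟨T - 1, by omega⟩
  rw [Nat.add_sub_cancel, ← sum_log_pcond hpX_pos]
  refine tendsto_finsetSum _ fun t ht => ?_
  have htT := Finset.mem_range.1 ht
  have := isProbabilityMeasure_Q1 hpz_meas hpz_nonneg hq_meas hq_nonneg hq_prob hpX hpX_pos t
  have hw_mean := integral_w hpz_meas hpz_nonneg hq_meas hq_nonneg hq_pos0 hq_pos hpX hpX_pos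
    hsupp t
  have hw0 := w_nonneg hpz_nonneg hq_nonneg t
  obtain ⟨M, hM⟩ := hbdd t htT
  have hw2 : MemLp (w pz q t) 2 (Q1 pz pX q t) := by
    refine MemLp.of_bound (measurable_w hpz_meas hq_meas t).aestronglyMeasurable M ?_
    filter_upwards [hM] with z hz
    rwa [Real.norm_of_nonneg (hw0 z)]
  rw [← hw_mean]
  exact tendsto_integral_log_average hw0 hw2 (hw_mean ▸ pcond_pos hpX_pos t) (hlogint t htT)
    (hint t)

end MCFO
end

section
/- (Score of the conditional marginal likelihood.) Let Θ ⊆ ℝ be open, θ0 ∈ Θ, and for each θ let p_θ(z_{1:t}, x_{1:t}) be a jointly measurable family of densities as in Fisher's identity (marginal likelihoods p_θ(x_{1:s}) = ∫ p_θ(z_{1:s}, x_{1:s}) dz_{1:s} ∈ (0, ∞), differentiability in θ at θ0 a.e., and local Lipschitz domination by an integrable function, at both time horizons s = t and s = t−1). Assume in addition the filtering consistency condition at θ0: ∫ p_{θ0}(z_{1:t}|x_{1:t}) dz_t = p_{θ0}(z_{1:t-1}|x_{1:t-1}) for a.e. z_{1:t-1}, where p_θ(z_{1:s}|x_{1:s})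 = p_θ(z_{1:s}, x_{1:s})/p_θ(x_{1:s}). Then ∂_θ log( p_θ(x_{1:t})/p_θ(x_{1:t-1}) )|_{θ0} = ∫ p_{θ0}(z_{1:t}|x_{1:t}) · ∂_θ log( p_θ(z_{1:t}, x_{1:t}) / p_θ(z_{1:t-1}, x_{1:t-1}) )|_{θ0} dz_{1:t}. -/
open MeasureTheory

open Filter Topology in
/-- Differentiation under the integral sign at a single point, where the Lipschitz bound at that
point holds only almost everywhere for each fixed parameter. -/
theorem integrable_and_hasDerivAt_integral_of_ae_lip {α : Type*} [MeasurableSpace α]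
    {μ : Measure α} {F : ℝ → α → ℝ} {F' g : α → ℝ} {x₀ : ℝ}
    (hF : ∀ᶠ x in 𝓝 x₀, Integrable (F x) μ) (hg : Integrable g μ)
    (hlip : ∀ᶠ x in 𝓝 x₀, ∀ᵐ a ∂μ, |F x a - F x₀ a| ≤ g a * |x - x₀|)
    (hderiv : ∀ᵐ a ∂μ, HasDerivAt (fun x => F x a) (F' a) x₀) :
    Integrable F' μ ∧ HasDerivAt (fun x => ∫ a, F x a ∂μ) (∫ a, F' a ∂μ) x₀ := by
  have hF₀ : Integrable (F x₀) μ := hF.self_of_nhds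
  have hslope : ∀ᶠ x in 𝓝[≠] x₀, Integrable (fun a => slope (fun x => F x a) x₀ x) μ := by
    filter_upwards [nhdsWithin_le_nhds hF] with x hx
    simp only [slope_def_module, smul_eq_mul]
    exact (hx.sub hF₀).const_mul _
  have hbound : ∀ᶠ x in 𝓝[≠] x₀, ∀ᵐ a ∂μ, ‖slope (fun x => F x a) x₀ x‖ ≤ g a := by
    filter_upwards [nhdsWithin_le_nhds hlip, self_mem_nhdsWithin] with x hx hne
    filter_upwards [hx] with a ha
    have hpos : 0 < |x - x₀| := abs_pos.2 (sub_ne_zero.2 hne)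
    rw [slope_def_field, Real.norm_eq_abs, abs_div, div_le_iff₀ hpos]
    exact ha
  have hlim : ∀ᵐ a ∂μ, Tendsto (fun x => slope (fun x => F x a) x₀ x) (𝓝[≠] x₀) (𝓝 (F' a)) := by
    filter_upwards [hderiv] with a ha
    exact hasDerivAt_iff_tendsto_slope.1 ha
  constructor
  · obtain ⟨u, hu⟩ := exists_seq_tendsto (𝓝[≠] x₀)
    obtain ⟨N, hN⟩ := eventually_atTop.1 (hu.eventually (hslope.and hbound))
    have hv : Tendsto (fun k => u (k + N)) atTop (𝓝[≠] x₀) := hu.comp (tendsto_add_atTop_nat N)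
    have hlim' : ∀ᵐ a ∂μ,
        Tendsto (fun k => slope (fun x => F x a) x₀ (u (k + N))) atTop (𝓝 (F' a)) := by
      filter_upwards [hlim] with a ha
      exact ha.comp hv
    have hbound' : ∀ᵐ a ∂μ, ∀ k, ‖slope (fun x => F x a) x₀ (u (k + N))‖ ≤ g a :=
      ae_all_iff.2 fun k => (hN (k + N) (Nat.le_add_left N k)).2
    refine hg.mono' (aestronglyMeasurable_of_tendsto_ae atTop
      (fun k => (hN (k + N) (Nat.le_add_left N k)).1.aestronglyMeasurable) hlim') ?_
    filter_upwards [hlim', hbound'] with a ha hb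
    exact le_of_tendsto ha.norm (Eventually.of_forall hb)
  · rw [hasDerivAt_iff_tendsto_slope]
    refine (tendsto_integral_filter_of_dominated_convergence g
      (hslope.mono fun x hx => hx.aestronglyMeasurable) hbound hg hlim).congr' ?_
    filter_upwards [nhdsWithin_le_nhds hF] with x hx
    simp only [slope_def_module, smul_eq_mul]
    rw [integral_const_mul, integral_sub hx hF₀]

/-- A function of the second variable, weighted by a nonnegative integrable density on a product,
integrates to its integral weighted by the marginal density. -/
theorem integrable_and_integral_mul_comp_snd {α β : Type*} [MeasurableSpace α]
    [MeasurableSpace β] {μ : Measure α} {ν : Measure β} [SFinite μ] [SFinite ν]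
    {f : α × β → ℝ} {w : β → ℝ} (hf : Integrable f (μ.prod ν)) (hf₀ : ∀ p, 0 ≤ f p)
    (hw : AEStronglyMeasurable w ν) (hmw : Integrable (fun b => (∫ a, f (a, b) ∂μ) * w b) ν) :
    Integrable (fun p : α × β => f p * w p.2) (μ.prod ν) ∧
      ∫ p, f p * w p.2 ∂(μ.prod ν) = ∫ b, (∫ a, f (a, b) ∂μ) * w b ∂ν := by
  have hint : Integrable (fun p : α × β => f p * w p.2) (μ.prod ν) := by
    refine (integrable_prod_iff' (hf.aestronglyMeasurable.mul hw.comp_snd)).2 ⟨?_, ?_⟩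
    · filter_upwards [hf.prod_left_ae] with b hb
      exact hb.mul_const (w b)
    · refine hmw.norm.congr (Filter.Eventually.of_forall fun b => ?_)
      simp only [Pi.mul_apply, norm_mul, integral_mul_const, Real.norm_eq_abs, abs_of_nonneg (hf₀ _)]
      rw [abs_of_nonneg (integral_nonneg fun a => hf₀ (a, b))]
  refine ⟨hint, ?_⟩
  rw [integral_prod_symm _ hint]
  simp only [integral_mul_const]

/-- A function of the initial segment of a tuple, weighted by a nonnegative integrable density,
integrates to its integral weighted by the density with the last coordinate integrated out. -/
theorem integrable_and_integral_mul_comp_init {E : Type*} [MeasureSpace E]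
    [SigmaFinite (volume : Measure E)] {n : ℕ} {f : (Fin (n + 1) → E) → ℝ}
    {w : (Fin n → E) → ℝ} (hf : Integrable f) (hf₀ : ∀ z, 0 ≤ f z)
    (hw : AEStronglyMeasurable w)
    (hmw : Integrable fun h => (∫ ζ, f (Fin.snoc h ζ : Fin (n + 1) → E)) * w h) :
    Integrable (fun z : Fin (n + 1) → E => f z * w (Fin.init z)) ∧
      ∫ z : Fin (n + 1) → E, f z * w (Fin.init z) =
        ∫ h, (∫ ζ, f (Fin.snoc h ζ : Fin (n + 1) → E)) * w h := by
  let e := MeasurableEquiv.piFinSuccAbove (fun _ : Fin (n + 1) => E) (Fin.last n)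
  have he : MeasurePreserving e.symm :=
    (volume_preserving_piFinSuccAbove (fun _ : Fin (n + 1) => E) (Fin.last n)).symm
  have he_apply : ∀ p : E × (Fin n → E), e.symm p = (Fin.snoc p.2 p.1 : Fin (n + 1) → E) :=
    fun p => Fin.insertNth_last' p.1 p.2
  have hfe : Integrable (fun p : E × (Fin n → E) => f (Fin.snoc p.2 p.1 : Fin (n + 1) → E)) := by
    simpa only [Function.comp_def, he_apply] using
      (he.integrable_comp_emb e.symm.measurableEmbedding).2 hf
  obtain ⟨h₁, h₂⟩ := integrable_and_integral_mul_comp_snd hfe (fun p => hf₀ _) hw hmw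
  constructor
  · rw [← he.integrable_comp_emb e.symm.measurableEmbedding]
    simpa only [Function.comp_def, he_apply, Fin.init_snoc, Measure.volume_eq_prod] using h₁
  · rw [← he.integral_comp e.symm.measurableEmbedding]
    simpa only [he_apply, Fin.init_snoc, Measure.volume_eq_prod] using h₂

/-- score of the conditional marginal likelihood: let `pc θ` be the joint
density `p_θ(z_{1:t}, x_{1:t})` (a function of the latent trajectory, the observations being
fixed) and `pp θ` the joint density `p_θ(z_{1:t-1}, x_{1:t-1})`, with marginal likelihoods
`Pc θ = p_θ(x_{1:t})` and `Pp θ = p_θ(x_{1:t-1})`, each family satisfying the hypotheses of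
Fisher's identity at `θ0` (measurability, positivity of the marginals, a.e. differentiability
with derivatives `Dc`, `Dp` vanishing outside the support, and local Lipschitz domination by
integrable functions), and assume the filtering consistency condition
`∫ p_{θ0}(z_{1:t}|x_{1:t}) dz_t = p_{θ0}(z_{1:t-1}|x_{1:t-1})` for a.e. `z_{1:t-1}`.  Then
`∂_θ log(Pc θ / Pp θ)|_{θ0}
  = ∫ p_{θ0}(z_{1:t}|x_{1:t}) ∂_θ log(pc θ (z_{1:t}) / pp θ (z_{1:t-1}))|_{θ0} dz_{1:t}`. -/
theorem score_of_conditional_marginal {dz n : ℕ}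
    (Θ : Set ℝ) (hΘ : IsOpen Θ) (θ0 : ℝ) (hθ0 : θ0 ∈ Θ)
    (pc : ℝ → (Fin (n + 1) → Fin dz → ℝ) → ℝ) (pp : ℝ → (Fin n → Fin dz → ℝ) → ℝ)
    (Pc Pp : ℝ → ℝ) (Dc : (Fin (n + 1) → Fin dz → ℝ) → ℝ) (Dp : (Fin n → Fin dz → ℝ) → ℝ)
    (hpc_meas : ∀ θ ∈ Θ, Measurable (pc θ)) (hpp_meas : ∀ θ ∈ Θ, Measurable (pp θ))
    (hpc_nonneg : ∀ θ ∈ Θ, ∀ z, 0 ≤ pc θ z) (hpp_nonneg : ∀ θ ∈ Θ, ∀ h, 0 ≤ pp θ h)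
    (hPc : ∀ θ ∈ Θ, Pc θ = ∫ z, pc θ z) (hPp : ∀ θ ∈ Θ, Pp θ = ∫ h, pp θ h)
    (hPc_pos : ∀ θ ∈ Θ, 0 < Pc θ) (hPp_pos : ∀ θ ∈ Θ, 0 < Pp θ)
    (hc_deriv : ∀ᵐ z ∂(volume : Measure (Fin (n + 1) → Fin dz → ℝ)),
      HasDerivAt (fun θ => pc θ z) (Dc z) θ0 ∧ (Dc z ≠ 0 → 0 < pc θ0 z))
    (hp_deriv : ∀ᵐ h ∂(volume : Measure (Fin n → Fin dz → ℝ)),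
      HasDerivAt (fun θ => pp θ h) (Dp h) θ0 ∧ (Dp h ≠ 0 → 0 < pp θ0 h))
    (gc : (Fin (n + 1) → Fin dz → ℝ) → ℝ) (hgc : Integrable gc)
    (gp : (Fin n → Fin dz → ℝ) → ℝ) (hgp : Integrable gp)
    (U : Set ℝ) (hU : U ∈ nhds θ0)
    (hc_lip : ∀ θ ∈ U, ∀ᵐ z ∂(volume : Measure (Fin (n + 1) → Fin dz → ℝ)),
      |pc θ z - pc θ0 z| ≤ gc z * |θ - θ0|)
    (hp_lip : ∀ θ ∈ U, ∀ᵐ h ∂(volume : Measure (Fin n → Fin dz → ℝ)),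
      |pp θ h - pp θ0 h| ≤ gp h * |θ - θ0|)
    (hfilt : ∀ᵐ h ∂(volume : Measure (Fin n → Fin dz → ℝ)),
      (∫ ζ : Fin dz → ℝ, pc θ0 (Fin.snoc h ζ) / Pc θ0) = pp θ0 h / Pp θ0) :
    HasDerivAt (fun θ => Real.log (Pc θ / Pp θ))
      (∫ z, pc θ0 z / Pc θ0 *
        (Dc z / pc θ0 z - Dp (Fin.init z) / pp θ0 (Fin.init z))) θ0 := by
  have hΘ_nhds : Θ ∈ nhds θ0 := hΘ.mem_nhds hθ0
  have hpc_int : ∀ θ ∈ Θ, Integrable (pc θ) := fun θ hθ =>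
    .of_integral_ne_zero (hPc θ hθ ▸ (hPc_pos θ hθ).ne')
  have hpp_int : ∀ θ ∈ Θ, Integrable (pp θ) := fun θ hθ =>
    .of_integral_ne_zero (hPp θ hθ ▸ (hPp_pos θ hθ).ne')
  obtain ⟨hDc, hPc_deriv⟩ := integrable_and_hasDerivAt_integral_of_ae_lip
    (Filter.eventually_of_mem hΘ_nhds hpc_int) hgc (Filter.eventually_of_mem hU hc_lip)
    (hc_deriv.mono fun _ h => h.1)
  obtain ⟨hDp, hPp_deriv⟩ := integrable_and_hasDerivAt_integral_of_ae_lip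
    (Filter.eventually_of_mem hΘ_nhds hpp_int) hgp (Filter.eventually_of_mem hU hp_lip)
    (hp_deriv.mono fun _ h => h.1)
  replace hPc_deriv : HasDerivAt Pc (∫ z, Dc z) θ0 :=
    hPc_deriv.congr_of_eventuallyEq (Filter.eventually_of_mem hΘ_nhds hPc)
  replace hPp_deriv : HasDerivAt Pp (∫ h, Dp h) θ0 :=
    hPp_deriv.congr_of_eventuallyEq (Filter.eventually_of_mem hΘ_nhds hPp)
  have hc₀ := hPc_pos θ0 hθ0
  have hp₀ := hPp_pos θ0 hθ0
  have hmarg : (fun h => (∫ ζ : Fin dz → ℝ, pc θ0 (Fin.snoc h ζ) / Pc θ0) * (Dp h / pp θ0 h))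
      =ᵐ[volume] fun h => Dp h / Pp θ0 := by
    filter_upwards [hfilt, hp_deriv] with h hh hd
    rw [hh]
    by_cases h0 : Dp h = 0
    · simp [h0]
    · have := (hd.2 h0).ne'
      field_simp
  obtain ⟨hint, hval⟩ := integrable_and_integral_mul_comp_init
    (f := fun z => pc θ0 z / Pc θ0) (w := fun h => Dp h / pp θ0 h)
    ((hpc_int θ0 hθ0).div_const _) (fun z => div_nonneg (hpc_nonneg θ0 hθ0 z) hc₀.le)
    (hDp.aestronglyMeasurable.aemeasurable.div
      (hpp_meas θ0 hθ0).aemeasurable).aestronglyMeasurable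
    ((hDp.div_const _).congr hmarg.symm)
  rw [integral_congr_ae hmarg, integral_div] at hval
  have hsplit : (fun z => pc θ0 z / Pc θ0 *
      (Dc z / pc θ0 z - Dp (Fin.init z) / pp θ0 (Fin.init z))) =ᵐ[volume]
      fun z => Dc z / Pc θ0 - pc θ0 z / Pc θ0 * (Dp (Fin.init z) / pp θ0 (Fin.init z)) := by
    filter_upwards [hc_deriv] with z hz
    rw [mul_sub]
    congr 1
    by_cases h0 : Dc z = 0
    · simp [h0]
    · have := (hz.2 h0).ne'
      field_simp
  rw [integral_congr_ae hsplit, integral_sub (hDc.div_const _) hint, hval, integral_div]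
  refine ((hPc_deriv.log hc₀.ne').sub (hPp_deriv.log hp₀.ne')).congr_of_eventuallyEq ?_
  filter_upwards [hΘ_nhds] with θ hθ
  exact Real.log_div (hPc_pos θ hθ).ne' (hPp_pos θ hθ).ne'
end
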